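/- Let A ∈ ℤ[[v,z]] be the power series in which the coefficient of v^k z^n is the number of grand Dyck paths P ∈ 𝒢_n with sv(P) = k, and let C(z) = Σ_{n≥0} Cat_n z^n be the generating function of the Catalan numbers. Then A·(1 − 2vzC(z)) = 1 in ℤ[[v,z]]. (Equivalently, A = 1/(1−v+v√(1−4z)), since 1−2zC(z) is the power-series square root of 1−4z.) -/

import Mathlib

/-- The height of the lattice path encoded by `w` (with `true = U`, `false = D`) after `j` steps. -/
def ht (w : List Bool) (j : ℕ) : ℤ :=
  ((w.take j).count true : ℤ) - ((w.take j).count false : ℤ)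

/-- A grand Dyck path of semilength `n`. -/
def IsGrandDyck (n : ℕ) (w : List Bool) : Prop :=
  w.length = 2 * n ∧ w.count true = n

/-- The number of symmetric vertices of a grand Dyck path of semilength `n`:
`sv(P) = #{i ∈ {0,…,n−1} : h_i = h_{2n−i}}`. -/
def svGD (n : ℕ) (w : List Bool) : ℕ :=
  ((Finset.range n).filter fun i => ht w i = ht w (2 * n - i)).card

/-- The series `A ∈ ℤ[[v,z]]` whose coefficient of `v^k z^n` is the number of grand Dyck
paths of semilength `n` with `k` symmetric vertices. Variable `0` is `v`, variable `1` is `z`. -/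
noncomputable def A : MvPowerSeries (Fin 2) ℤ := fun d =>
  ({w : List Bool | IsGrandDyck (d 1) w ∧ svGD (d 1) w = d 0}.ncard : ℤ)

/-- The Catalan generating function `C(z) = Σ_{n≥0} Cat_n z^n`, viewed in `ℤ[[v,z]]`. -/
noncomputable def Cgf : MvPowerSeries (Fin 2) ℤ := fun d =>
  if d 0 = 0 then (catalan (d 1) : ℤ) else 0

/-- Words of length `2n` with final height `-2h` and `k` symmetric vertices. -/
def SW (n : ℕ) (h : ℤ) (k : ℕ) : Set (List Bool) :=
  {w | w.length = 2 * n ∧ (w.count true : ℤ) + h = n ∧ svGD n w = k}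

/-- Add a first and a last letter. -/
def wrapW (a b : Bool) (w : List Bool) : List Bool := a :: (w ++ [b])

/-- The step of a letter. -/
def stepW (a : Bool) : ℤ := if a then 1 else 0

theorem SW_finite (n : ℕ) (h : ℤ) (k : ℕ) : (SW n h k).Finite :=
  (List.finite_length_eq Bool (2 * n)).subset fun _ hw => hw.1

theorem wrapW_inj (a b : Bool) : Function.Injective (wrapW a b) := by
  intro x y hxy
  simpa [wrapW] using hxy

theorem ht_wrapW (a b : Bool) (w : List Bool) (j : ℕ) (hj : j ≤ w.length) :
    ht (wrapW a b w) (j + 1) = (2 * stepW a - 1) + ht w j := by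
  unfold ht wrapW stepW
  rw [List.take_succ_cons, List.take_append_of_le_length hj]
  cases a <;> simp <;> ring

theorem count_bool (w : List Bool) : w.count true + w.count false = w.length := by
  induction w with
  | nil => simp
  | cons a w ih => cases a <;> simp <;> omega

theorem ht_full (n : ℕ) (w : List Bool) (h : ℤ) (hl : w.length = 2 * n)
    (hc : (w.count true : ℤ) + h = n) : ht w (2 * n) = - (2 * h) := by
  unfold ht
  rw [List.take_of_length_le (by omega)]
  have := count_bool w
  omega

theorem svGD_wrapW (n : ℕ) (a b : Bool) (w : List Bool) (h : ℤ) (hl : w.length = 2 * n)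
    (hc : ((wrapW a b w).count true : ℤ) + h = (n + 1 : ℕ)) :
    svGD (n + 1) (wrapW a b w) = svGD n w + if h = 0 then 1 else 0 := by
  unfold svGD
  rw [Finset.card_filter, Finset.card_filter, Finset.sum_range_succ']
  congr 1
  · apply Finset.sum_congr rfl
    intro i hi
    have hi := Finset.mem_range.1 hi
    rw [show 2 * (n + 1) - (i + 1) = (2 * n - i) + 1 by omega, ht_wrapW _ _ _ _ (by omega),
      ht_wrapW _ _ _ _ (by omega)]
    simp
  · have h1 : ht (wrapW a b w) (2 * (n + 1)) = - (2 * h) :=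
      ht_full (n + 1) _ h (by simp [wrapW]; omega) hc
    rw [Nat.sub_zero, h1]
    have h0 : ht (wrapW a b w) 0 = 0 := by simp [ht]
    rw [h0]
    have : (0 = -(2 * h)) ↔ h = 0 := by omega
    simp [this]

theorem count_wrapW (a b : Bool) (w : List Bool) :
    ((wrapW a b w).count true : ℤ) = w.count true + stepW a + stepW b := by
  cases a <;> cases b <;> simp [wrapW, stepW]

theorem exists_wrapW (n : ℕ) (w : List Bool) (hl : w.length = 2 * (n + 1)) :
    ∃ a b u, u.length = 2 * n ∧ w = wrapW a b u := by
  cases w with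
  | nil => simp at hl
  | cons a w =>
    rcases List.eq_nil_or_concat w with rfl | ⟨u, b, rfl⟩
    · simp at hl; omega
    · refine ⟨a, b, u, ?_, ?_⟩
      · simp at hl; omega
      · simp [wrapW]

theorem mem_SW_wrapW (n : ℕ) (h : ℤ) (k : ℕ) (a b : Bool) (u : List Bool) :
    wrapW a b u ∈ SW (n + 1) h (k + if h = 0 then 1 else 0) ↔
      u ∈ SW n (h + stepW a + stepW b - 1) k := by
  unfold SW
  simp only [Set.mem_ofPred_eq]
  have hlen : (wrapW a b u).length = u.length + 2 := by simp [wrapW]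
  have hcnt := count_wrapW a b u
  constructor
  · rintro ⟨h1, h2, h3⟩
    have hl : u.length = 2 * n := by omega
    rw [svGD_wrapW n a b u h hl h2] at h3
    refine ⟨hl, by push_cast at h2; linarith, by omega⟩
  · rintro ⟨hl, h2, h3⟩
    have h2' : ((wrapW a b u).count true : ℤ) + h = (n + 1 : ℕ) := by push_cast; linarith
    refine ⟨by omega, h2', ?_⟩
    rw [svGD_wrapW n a b u h hl h2', h3]

theorem SW_succ (n : ℕ) (h : ℤ) (k : ℕ) :
    SW (n + 1) h (k + if h = 0 then 1 else 0) =
      ((Set.image (wrapW true true) (SW n (h + 1) k) ∪ Set.image (wrapW false false) (SW n (h - 1) k)) ∪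
      (Set.image (wrapW true false) (SW n h k) ∪ Set.image (wrapW false true) (SW n h k))) := by
  ext w
  constructor
  · intro hw
    obtain ⟨a, b, u, hu, rfl⟩ := exists_wrapW n w hw.1
    have := (mem_SW_wrapW n h k a b u).1 hw
    cases a <;> cases b <;> simp [stepW] at this
    · exact Or.inl (Or.inr ⟨u, this, rfl⟩)
    · exact Or.inr (Or.inr ⟨u, this, rfl⟩)
    · exact Or.inr (Or.inl ⟨u, this, rfl⟩)
    · exact Or.inl (Or.inl ⟨u, this, rfl⟩)
  · rintro ((⟨u, hu, rfl⟩ | ⟨u, hu, rfl⟩) | (⟨u, hu, rfl⟩ | ⟨u, hu, rfl⟩)) <;>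
      rw [mem_SW_wrapW] <;> simpa [stepW] using hu

theorem wrapW_disj (a b c d : Bool) (hne : (a, b) ≠ (c, d)) (s t : Set (List Bool)) :
    Disjoint (Set.image (wrapW a b) (s)) (Set.image (wrapW c d) (t)) := by
  rw [Set.disjoint_left]
  rintro _ ⟨u, _, rfl⟩ ⟨v, _, hv⟩
  simp only [wrapW, List.cons.injEq] at hv
  have := List.append_inj' hv.2 rfl
  simp at this
  exact hne (by rw [hv.1, this.2])

theorem ncard_SW_succ (n : ℕ) (h : ℤ) (k : ℕ) :
    (SW (n + 1) h (k + if h = 0 then 1 else 0)).ncard =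
      (SW n (h + 1) k).ncard + (SW n (h - 1) k).ncard + 2 * (SW n h k).ncard := by
  have hf : ∀ a b h, (Set.image (wrapW a b) (SW n h k)).Finite := fun a b h => (SW_finite n h k).image _
  rw [SW_succ, Set.ncard_union_eq ?_ ((hf _ _ _).union (hf _ _ _)) ((hf _ _ _).union (hf _ _ _)),
    Set.ncard_union_eq ?_ (hf _ _ _) (hf _ _ _), Set.ncard_union_eq ?_ (hf _ _ _) (hf _ _ _)]
  · simp only [Set.ncard_image_of_injective _ (wrapW_inj _ _)]
    ring
  · exact wrapW_disj _ _ _ _ (by simp) _ _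
  · exact wrapW_disj _ _ _ _ (by simp) _ _
  · simp only [Set.disjoint_union_left, Set.disjoint_union_right]
    refine ⟨⟨?_, ?_⟩, ?_, ?_⟩ <;> exact wrapW_disj _ _ _ _ (by simp) _ _

theorem ncard_SW_succ_zero (n : ℕ) : (SW (n + 1) 0 0).ncard = 0 := by
  rw [Set.ncard_eq_zero (SW_finite _ _ _)]
  ext w
  simp only [Set.mem_empty_iff_false, iff_false]
  intro hw
  obtain ⟨a, b, u, hu, rfl⟩ := exists_wrapW n w hw.1
  have := svGD_wrapW n a b u 0 hu hw.2.1
  rw [hw.2.2] at this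
  simp at this

theorem ncard_SW_zero (h : ℤ) (k : ℕ) :
    (SW 0 h k).ncard = if h = 0 ∧ k = 0 then 1 else 0 := by
  split_ifs with hk
  · obtain ⟨rfl, rfl⟩ := hk
    rw [Set.ncard_eq_one]
    refine ⟨[], ?_⟩
    ext w
    simp only [SW, Set.mem_ofPred_eq, Set.mem_singleton_iff]
    constructor
    · intro hw; exact List.length_eq_zero_iff.1 (by simpa using hw.1)
    · rintro rfl; simp [svGD]
  · rw [Set.ncard_eq_zero (SW_finite _ _ _)]
    ext w
    simp only [Set.mem_empty_iff_false, iff_false]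
    rintro ⟨h1, h2, h3⟩
    have : w = [] := List.length_eq_zero_iff.1 (by simpa using h1)
    subst this
    simp [svGD] at h2 h3
    exact hk ⟨h2, h3.symm⟩

/-- Generating function of the words with final height `-2h`. -/
noncomputable def GS (h : ℤ) : MvPowerSeries (Fin 2) ℤ := fun d =>
  ((SW (d 1) h (d 0)).ncard : ℤ)

theorem A_eq_GS : A = GS 0 := by
  funext d
  simp only [A, GS, SW, IsGrandDyck]
  congr 2
  ext w
  simp [and_assoc]

theorem coeff_X_mul_if (s : Fin 2) (F : MvPowerSeries (Fin 2) ℤ) (d : Fin 2 →₀ ℕ) :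
    MvPowerSeries.coeff d (MvPowerSeries.X s * F) =
      if d s = 0 then 0 else MvPowerSeries.coeff (d - Finsupp.single s 1) F := by
  rw [MvPowerSeries.X_def, MvPowerSeries.coeff_monomial_mul]
  by_cases hd : d s = 0
  · rw [if_pos hd, if_neg]
    rw [Finsupp.single_le_iff]
    omega
  · rw [if_neg hd, if_pos, one_mul]
    rw [Finsupp.single_le_iff]
    omega

theorem coeff_GS (h : ℤ) (d : Fin 2 →₀ ℕ) :
    MvPowerSeries.coeff d (GS h) = ((SW (d 1) h (d 0)).ncard : ℤ) := rfl

theorem finsupp_eq_zero_iff (d : Fin 2 →₀ ℕ) : d = 0 ↔ d 0 = 0 ∧ d 1 = 0 := by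
  constructor
  · rintro rfl; simp
  · rintro ⟨h0, h1⟩
    ext i
    fin_cases i <;> simpa

theorem two_mul_coeff (F : MvPowerSeries (Fin 2) ℤ) (d : Fin 2 →₀ ℕ) :
    MvPowerSeries.coeff d (2 * F) = 2 * MvPowerSeries.coeff d F := by
  rw [two_mul, two_mul, map_add]

theorem GS_zero : GS 0 = 1 + MvPowerSeries.X 1 *
    (MvPowerSeries.X 0 * (GS (0 + 1) + GS (0 - 1) + 2 * GS 0)) := by
  ext d
  rw [map_add, coeff_X_mul_if, coeff_X_mul_if, MvPowerSeries.coeff_one, coeff_GS, map_add, map_add,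
    two_mul_coeff]
  simp only [coeff_GS, finsupp_eq_zero_iff d]
  rcases hn : d 1 with _ | n
  · rw [ncard_SW_zero]; simp
  · rcases hk : d 0 with _ | k
    · rw [ncard_SW_succ_zero]; simp [hk]
    · have := ncard_SW_succ n 0 k
      simp only [if_true] at this
      rw [this]
      simp [hn, hk]

theorem GS_ne (h : ℤ) (hh : h ≠ 0) : GS h = MvPowerSeries.X 1 *
    (GS (h + 1) + GS (h - 1) + 2 * GS h) := by
  ext d
  rw [coeff_X_mul_if, coeff_GS, map_add, map_add, two_mul_coeff]
  simp only [coeff_GS]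
  rcases hn : d 1 with _ | n
  · rw [ncard_SW_zero]; simp [hh]
  · have := ncard_SW_succ n h (d 0)
    rw [if_neg hh, add_zero] at this
    rw [this]
    simp [hn]

theorem coeff_Cgf (d : Fin 2 →₀ ℕ) :
    MvPowerSeries.coeff d Cgf = if d 0 = 0 then (catalan (d 1) : ℤ) else 0 := rfl

theorem coeff_Cgf_sq (d : Fin 2 →₀ ℕ) :
    MvPowerSeries.coeff d (Cgf * Cgf) = if d 0 = 0 then (catalan (d 1 + 1) : ℤ) else 0 := by
  classical
  rw [MvPowerSeries.coeff_mul]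
  simp only [coeff_Cgf]
  split_ifs with hd
  · have hd' : d = Finsupp.single 1 (d 1) := by
      ext i
      fin_cases i <;> simp [hd]
    generalize d 1 = n at hd'
    subst hd'
    rw [Finsupp.antidiagonal_single, Finset.sum_map, catalan_succ']
    simp
  · apply Finset.sum_eq_zero
    rintro ⟨p, q⟩ hpq
    rw [Finset.HasAntidiagonal.mem_antidiagonal] at hpq
    have : p 0 + q 0 = d 0 := by rw [← hpq]; rfl
    by_cases hp : p 0 = 0
    · have hq : q 0 ≠ 0 := by omega
      simp [hq]
    · simp [hp]

theorem Cgf_eq : Cgf = 1 + MvPowerSeries.X 1 * (Cgf * Cgf) := by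
  ext d
  rw [map_add, coeff_X_mul_if, MvPowerSeries.coeff_one, coeff_Cgf, coeff_Cgf_sq]
  simp only [finsupp_eq_zero_iff d]
  by_cases h0 : d 0 = 0
  · rcases hn : d 1 with _ | n
    · simp [h0]
    · simp [h0, hn]
  · simp [h0]

/-- Uniqueness of the solution of the linear system. -/
theorem uniq_zero (u D : ℤ → MvPowerSeries (Fin 2) ℤ)
    (hD : ∀ h, D h = MvPowerSeries.X 1 * (u h * (D (h + 1) + D (h - 1) + 2 * D h))) (h : ℤ) :
    D h = 0 := by
  have key : ∀ n : ℕ, ∀ h, (MvPowerSeries.X 1 : MvPowerSeries (Fin 2) ℤ) ^ n ∣ D h := by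
    intro n
    induction n with
    | zero => intro h; simp
    | succ n ih =>
      intro h
      rw [hD h, pow_succ']
      exact mul_dvd_mul_left _ (Dvd.dvd.mul_left
        (dvd_add (dvd_add (ih _) (ih _)) (Dvd.dvd.mul_left (ih _) _)) _)
  ext d
  rw [map_zero]
  exact MvPowerSeries.X_pow_dvd_iff.1 (key (d 1 + 1) h) d (Nat.lt_succ_self _)

/-- `A·(1 − 2vzC(z)) = 1` in `ℤ[[v,z]]`, i.e. `A = 1/(1 − v + v√(1−4z))`. -/
theorem grandDyck_sv_gf :
    A * (1 - 2 * MvPowerSeries.X 0 * MvPowerSeries.X 1 * Cgf) = 1 := by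
  have hC := Cgf_eq
  have hu : IsUnit (1 - 2 * MvPowerSeries.X 0 * MvPowerSeries.X 1 * Cgf :
      MvPowerSeries (Fin 2) ℤ) := by
    rw [MvPowerSeries.isUnit_iff_constantCoeff]
    simp
  obtain ⟨B, hB⟩ := hu.exists_left_inv
  have hr : Cgf - 1 = MvPowerSeries.X 1 * ((Cgf - 1) * (Cgf - 1) + 1 + 2 * (Cgf - 1)) := by
    linear_combination hC
  have h0 := uniq_zero (fun h => if h = 0 then MvPowerSeries.X 0 else 1)
    (fun h => GS h - (Cgf - 1) ^ h.natAbs * B) ?_ 0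
  · have h1 : GS 0 = B := by simpa [sub_eq_zero] using h0
    rw [A_eq_GS, h1, hB]
  · intro h
    rcases lt_trichotomy h 0 with hh | hh | hh
    · obtain ⟨m, rfl⟩ : ∃ m : ℕ, h = -((m : ℤ) + 1) := ⟨(-h - 1).toNat, by omega⟩
      have e1 : (-((m : ℤ) + 1)).natAbs = m + 1 := by omega
      have e2 : (-((m : ℤ) + 1) + 1).natAbs = m := by omega
      have e3 : (-((m : ℤ) + 1) - 1).natAbs = m + 2 := by omega
      have hg := GS_ne _ hh.ne
      simp only [if_neg hh.ne, e1, e2, e3]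
      linear_combination hg - (Cgf - 1) ^ m * B * hr
    · subst hh
      have hg := GS_zero
      simp only [if_true] at hg ⊢
      norm_num at hg ⊢
      linear_combination hg - hB
    · obtain ⟨m, rfl⟩ : ∃ m : ℕ, h = (m : ℤ) + 1 := ⟨(h - 1).toNat, by omega⟩
      have e1 : ((m : ℤ) + 1).natAbs = m + 1 := by omega
      have e2 : ((m : ℤ) + 1 + 1).natAbs = m + 2 := by omega
      have e3 : ((m : ℤ) + 1 - 1).natAbs = m := by omega
      have hg := GS_ne _ hh.ne'
      simp only [if_neg hh.ne', e1, e2, e3]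
      linear_combination hg - (Cgf - 1) ^ m * B * hr
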